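/- Let m ∈ ℕ, n : Fin m → ℕ, and let B_S be the associated 3-cost game board. For every strategy s on B_S such that P*_s is closed, and for every i ∈ Fin m, the set final(P*_s) contains exactly one of the two positions pⁱ↑ and pⁱ↓, and final(P*_s) contains no position other than these leaves; in particular |final(P*_s)| = m. -/

import Mathlib

open Classical

/-- A `k`-cost game board: positions `P` (finite) partitioned into controller
positions `Pc` (`P∘`) and spoiler positions `Psq` (`P□`), an initial position `p0`,
a set `F` of final positions with no outgoing edges, a cost function `C : P → ℝ^k`,
and an acyclic edge relation `M`. -/
structure CostGameBoard (k : ℕ) (P : Type) [Fintype P] where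
  Pc : Set P
  Psq : Set P
  p0 : P
  F : Set P
  C : P → Fin k → ℝ
  M : P → P → Prop
  cover : Pc ∪ Psq = Set.univ
  disj : Pc ∩ Psq = ∅
  acyclic : ∀ p : P, ¬ Relation.TransGen M p p
  final_no_out : ∀ p ∈ F, ∀ p' : P, ¬ M p p'

variable {k : ℕ} {P : Type} [Fintype P]

/-- `s` is a strategy: whenever the last position of a nonempty sequence has an
outgoing `M`-edge, the strategy picks an `M`-successor of it. -/
def IsStrategy (B : CostGameBoard k P) (s : List P → P) : Prop :=
  ∀ (ρ : List P) (p : P), ρ.getLast? = some p → (∃ p', B.M p p') → B.M p (s ρ)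

/-- `ρ` is a successful play generated by `s`: it is nonempty, starts at `p0`,
follows `M`-edges, ends in `F`, and follows `s` at controller positions. -/
def IsPlay (B : CostGameBoard k P) (s : List P → P) (ρ : List P) : Prop :=
  ρ ≠ [] ∧
  ρ.head? = some B.p0 ∧
  (∀ (i : ℕ) (p p' : P), ρ[i]? = some p → ρ[i + 1]? = some p' → B.M p p') ∧
  (∃ p ∈ B.F, ρ.getLast? = some p) ∧
  (∀ (i : ℕ) (p p' : P), ρ[i]? = some p → ρ[i + 1]? = some p' →
      p ∈ B.Pc → p' = s (ρ.take (i + 1)))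

/-- `P*_s`: the set of successful plays generated by `s`. -/
def Plays (B : CostGameBoard k P) (s : List P → P) : Set (List P) :=
  {ρ | IsPlay B s ρ}

/-- `P*_s` is closed: at every spoiler position occurring (not last) in a play,
every alternative spoiler move can be extended to a play with the same prefix. -/
def ClosedPlays (B : CostGameBoard k P) (s : List P → P) : Prop :=
  ∀ ρ ∈ Plays B s, ∀ (i : ℕ) (p p' : P), ρ[i]? = some p → i + 1 < ρ.length →
    p ∈ B.Psq → B.M p p' →
      ∃ ρ' ∈ Plays B s, ρ'.take (i + 1) = ρ.take (i + 1) ∧ ρ'[i + 1]? = some p'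

/-- `final(P*_s)`: the set of last positions of successful plays generated by `s`. -/
def finals (B : CostGameBoard k P) (s : List P → P) : Set P :=
  {p | ∃ ρ ∈ Plays B s, ρ.getLast? = some p}

/-- The `j`-th component of `∑_{p ∈ final(P*_s)} C(p)`. -/
noncomputable def finalCost (B : CostGameBoard k P) (s : List P → P) (j : Fin k) : ℝ :=
  ∑ p ∈ (Set.toFinite (finals B s)).toFinset, B.C p j

/-- Positions of the board `B_S` associated with a Distinct Partition instance:
the initial position `p₀`, and for each index `i` the positions `pⁱ`, `pⁱ↑`, `pⁱ↓`. -/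
inductive PartPos (m : ℕ) : Type
  | start : PartPos m
  | mid : Fin m → PartPos m
  | up : Fin m → PartPos m
  | down : Fin m → PartPos m
  deriving DecidableEq, Fintype

/-- Edges of the board `B_S`. -/
inductive partM (m : ℕ) : PartPos m → PartPos m → Prop
  | toMid (i : Fin m) : partM m .start (.mid i)
  | toUp (i : Fin m) : partM m (.mid i) (.up i)
  | toDown (i : Fin m) : partM m (.mid i) (.down i)

/-- Costs of the board `B_S`: `C(pⁱ↑) = (n i, 0, 1)`, `C(pⁱ↓) = (0, n i, 1)`,
and `(0,0,0)` elsewhere. -/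
def partC {m : ℕ} (n : Fin m → ℕ) : PartPos m → Fin 3 → ℝ
  | .up i => ![(n i : ℝ), 0, 1]
  | .down i => ![0, (n i : ℝ), 1]
  | _ => ![0, 0, 0]

/-- Rank function witnessing acyclicity of `partM`. -/
def partRank {m : ℕ} : PartPos m → ℕ
  | .start => 0
  | .mid _ => 1
  | .up _ => 2
  | .down _ => 2

lemma partM_rank {m : ℕ} {p q : PartPos m} (h : partM m p q) : partRank p < partRank q := by
  cases h <;> simp [partRank]

/-- The 3-cost game board `B_S` associated with a Distinct Partition instance. -/
def partBoard (m : ℕ) (n : Fin m → ℕ) : CostGameBoard 3 (PartPos m) where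
  Pc := {p | p ≠ .start}
  Psq := {.start}
  p0 := .start
  F := {p | ∃ i : Fin m, p = .up i ∨ p = .down i}
  C := partC n
  M := partM m
  cover := by
    ext p
    by_cases h : p = PartPos.start <;> simp [h]
  disj := by
    ext p
    simp only [Set.mem_inter_iff, Set.mem_setOf_eq, Set.mem_singleton_iff, Set.mem_empty_iff_false,
      iff_false, not_and]
    tauto
  acyclic := by
    intro p hp
    have key : ∀ a b : PartPos m, Relation.TransGen (partM m) a b → partRank a < partRank b := by
      intro a b h
      induction h with
      | single h => exact partM_rank h
      | tail _ h ih => exact ih.trans (partM_rank h)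
    exact lt_irrefl _ (key p p hp)
  final_no_out := by
    rintro p ⟨i, hi | hi⟩ p' hM <;> subst hi <;> cases hM

/-- At `pⁱ`, a strategy on `B_S` moves to one of the two leaves `pⁱ↑`, `pⁱ↓`. -/
lemma IsStrategy.partBoard_reply {m : ℕ} {n : Fin m → ℕ} {s : List (PartPos m) → PartPos m}
    (hs : IsStrategy (partBoard m n) s) (i : Fin m) :
    s [.start, .mid i] = .up i ∨ s [.start, .mid i] = .down i := by
  have h : partM m (.mid i) (s [.start, .mid i]) :=
    hs [.start, .mid i] (.mid i) rfl ⟨.up i, partM.toUp i⟩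
  generalize s [.start, .mid i] = q at h
  cases h <;> simp

/-- Every successful play on `B_S` has the form `p₀, pⁱ, s(p₀, pⁱ)`. -/
lemma IsPlay.eq_of_partBoard {m : ℕ} {n : Fin m → ℕ} {s : List (PartPos m) → PartPos m}
    {ρ : List (PartPos m)} (h : IsPlay (partBoard m n) s ρ) :
    ∃ i : Fin m, ρ = [.start, .mid i, s [.start, .mid i]] := by
  obtain ⟨-, hhead, hM, ⟨f, ⟨j, hf⟩, hlast⟩, hs⟩ := h
  change ∀ (i : ℕ) (p p' : PartPos m), ρ[i]? = some p → ρ[i + 1]? = some p' → partM m p p' at hM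
  match ρ, hhead with
  | [a], hhead =>
    obtain rfl : a = .start := Option.some.inj hhead
    obtain rfl : PartPos.start = f := by simpa using hlast
    simp at hf
  | a :: b :: l, hhead =>
    obtain rfl : a = .start := Option.some.inj hhead
    have hb : partM m .start b := hM 0 _ _ rfl rfl
    cases hb with
    | toMid i =>
      refine ⟨i, ?_⟩
      match l with
      | [] =>
        obtain rfl : PartPos.mid i = f := by simpa using hlast
        simp at hf
      | [c] =>
        have hc : c = s [.start, .mid i] :=
          hs 1 (.mid i) c rfl rfl (by simp [partBoard])
        rw [hc]
      | c :: d :: l =>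
        have hc : partM m (.mid i) c := hM 1 _ _ rfl rfl
        have hd : partM m c d := hM 2 _ _ rfl rfl
        cases hc <;> cases hd

/-- The sequence `p₀, pⁱ, s(p₀, pⁱ)` is a successful play on `B_S`. -/
lemma IsStrategy.isPlay_partBoard {m : ℕ} {n : Fin m → ℕ} {s : List (PartPos m) → PartPos m}
    (hs : IsStrategy (partBoard m n) s) (i : Fin m) :
    IsPlay (partBoard m n) s [.start, .mid i, s [.start, .mid i]] := by
  refine ⟨by simp, rfl, ?_, ⟨_, ⟨i, hs.partBoard_reply i⟩, rfl⟩, ?_⟩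
  · rintro (_ | _ | j) p p' hp hp'
    · obtain rfl : PartPos.start = p := by simpa using hp
      obtain rfl : PartPos.mid i = p' := by simpa using hp'
      exact partM.toMid i
    · obtain rfl : PartPos.mid i = p := by simpa using hp
      obtain rfl : s [.start, .mid i] = p' := by simpa using hp'
      exact hs [.start, .mid i] (.mid i) rfl ⟨.up i, partM.toUp i⟩
    · simp at hp'
  · rintro (_ | _ | j) p p' hp hp' hc
    · obtain rfl : PartPos.start = p := by simpa using hp
      exact absurd rfl hc
    · simpa using hp'.symm
    · simp at hp'

/-- The final positions reached by a strategy on `B_S` are its replies at the positions `pⁱ`. -/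
lemma IsStrategy.finals_partBoard {m : ℕ} {n : Fin m → ℕ} {s : List (PartPos m) → PartPos m}
    (hs : IsStrategy (partBoard m n) s) :
    finals (partBoard m n) s = Set.range fun i : Fin m => s [.start, .mid i] := by
  ext p
  constructor
  · rintro ⟨ρ, hρ, hp⟩
    obtain ⟨i, rfl⟩ := hρ.eq_of_partBoard
    exact ⟨i, by simpa using hp⟩
  · rintro ⟨i, rfl⟩
    exact ⟨_, hs.isPlay_partBoard i, rfl⟩

/-- For every strategy on `B_S` whose set of plays is closed, the set of final
positions contains exactly one of `pⁱ↑`, `pⁱ↓` for each `i`, contains nothing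
besides these leaves, and hence has cardinality `m`. -/
theorem partBoard_finals_structure (m : ℕ) (n : Fin m → ℕ)
    (s : List (PartPos m) → PartPos m)
    (hstrat : IsStrategy (partBoard m n) s)
    (hclosed : ClosedPlays (partBoard m n) s) :
    (∀ i : Fin m,
        Xor' (PartPos.up i ∈ finals (partBoard m n) s)
          (PartPos.down i ∈ finals (partBoard m n) s)) ∧
    (∀ p ∈ finals (partBoard m n) s, ∃ i : Fin m, p = .up i ∨ p = .down i) ∧
    (Set.toFinite (finals (partBoard m n) s)).toFinset.card = m := by
  have hreply := hstrat.partBoard_reply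
  have hmem : ∀ i j : Fin m, (s [.start, .mid j] = .up i ∨ s [.start, .mid j] = .down i) →
      j = i := by
    intro i j h
    rcases hreply j with hj | hj <;> simpa [hj] using h
  have hinj : Function.Injective fun i : Fin m => s [.start, .mid i] := by
    intro i j (hij : s [.start, .mid i] = s [.start, .mid j])
    exact hmem j i (hij ▸ hreply j)
  refine ⟨fun i => ?_, ?_, ?_⟩
  · rw [hstrat.finals_partBoard]
    rcases hreply i with hi | hi
    · refine Or.inl ⟨⟨i, hi⟩, ?_⟩
      rintro ⟨j, hj⟩
      obtain rfl := hmem i j (Or.inr hj)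
      simp [hi] at hj
    · refine Or.inr ⟨⟨i, hi⟩, ?_⟩
      rintro ⟨j, hj⟩
      obtain rfl := hmem i j (Or.inl hj)
      simp [hi] at hj
  · rw [hstrat.finals_partBoard]
    rintro _ ⟨i, rfl⟩
    exact ⟨i, hreply i⟩
  · rw [← Set.ncard_eq_toFinset_card, hstrat.finals_partBoard, ← Set.image_univ,
      Set.ncard_image_of_injective _ hinj, Set.ncard_univ, Nat.card_fin]
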